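/- Let ϑ_P be a primitive random substitution with Perron–Frobenius eigenvalue λ, right Perron–Frobenius eigenvector R and frequency measure μ_P. Then for every k ∈ N, h(μ_P) ≥ λ^{-k}·H_k^T R − H(λ^{-k}). If, in addition, ϑ_P has unique realisation paths, then h(μ_P) ≥ λ^{-k}·H_k^T R for every k ∈ N. -/

import Mathlib

open Filter MeasureTheory

namespace RandomSubstitutionTheory

variable {A : Type*} [Fintype A] [DecidableEq A]

/-- The set of realisations of `ϑ(u)` for a word `u`. -/
def reals (θ : A → Finset (List A)) : List A → Finset (List A)
  | [] => {[]}
  | a :: u => (θ a).biUnion fun v => (reals θ u).image fun w => v ++ w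

/-- The set of realisations of `ϑ^n(u)` for a word `u`. -/
def realsIter (θ : A → Finset (List A)) : ℕ → List A → Finset (List A)
  | 0, u => {u}
  | n + 1, u => (reals θ u).biUnion fun v => realsIter θ n v

/-- `wordProb θ P u w` is the probability `P[ϑ_P(u) = w]`, each letter of `u` being
substituted independently. -/
noncomputable def wordProb (θ : A → Finset (List A)) (P : A → List A → ℝ) :
    List A → List A → ℝ
  | [], w => if w = [] then 1 else 0
  | a :: u, w =>
      ∑ v ∈ θ a, P a v * (if v <+: w then wordProb θ P u (w.drop v.length) else 0)

/-- `iterProb θ P n u w` is the probability `P[ϑ_P^n(u) = w]` of the induced Markov chain. -/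
noncomputable def iterProb (θ : A → Finset (List A)) (P : A → List A → ℝ) :
    ℕ → List A → List A → ℝ
  | 0, u, w => if u = w then 1 else 0
  | n + 1, u, w => ∑ v ∈ reals θ u, wordProb θ P u v * iterProb θ P n v w

/-- The substitution matrix `M_{ij} = E[|ϑ_P(a_j)|_{a_i}]`. -/
noncomputable def substM (θ : A → Finset (List A)) (P : A → List A → ℝ) :
    Matrix A A ℝ :=
  Matrix.of fun i j => ∑ w ∈ θ j, P j w * (w.count i : ℝ)

/-- The defining data of a random substitution: nonempty finite sets of nonempty words
and strictly positive probability vectors. -/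
def IsRandomSubstitution (θ : A → Finset (List A)) (P : A → List A → ℝ) : Prop :=
  (∀ a, (θ a).Nonempty) ∧ (∀ a, ∀ w ∈ θ a, w ≠ []) ∧
    (∀ a, ∀ w ∈ θ a, 0 < P a w) ∧ (∀ a w, w ∉ θ a → P a w = 0) ∧
    ∀ a, ∑ w ∈ θ a, P a w = 1

/-- Primitivity of the substitution matrix: some power has strictly positive entries. -/
def IsPrimitive (θ : A → Finset (List A)) (P : A → List A → ℝ) : Prop :=
  ∃ k : ℕ, ∀ i j : A, 0 < (substM θ P ^ k) i j

/-- The Perron–Frobenius eigenvalue is `> 1` (witnessed by a positive right eigenvector). -/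
def IsExpanding (θ : A → Finset (List A)) (P : A → List A → ℝ) : Prop :=
  ∃ lam : ℝ, 1 < lam ∧ ∃ R : A → ℝ, (∀ a, 0 < R a) ∧ (substM θ P).mulVec R = lam • R

/-- A word is legal if it occurs as a subword of some level-`k` inflation word. -/
def Legal (θ : A → Finset (List A)) (u : List A) : Prop :=
  ∃ (a : A) (k : ℕ) (w : List A), w ∈ realsIter θ k [a] ∧ u <:+: w

/-- All words of length `n` over the alphabet. -/
def allWords (A : Type*) [Fintype A] [DecidableEq A] (n : ℕ) : Finset (List A) :=
  (Finset.univ : Finset (Fin n → A)).image List.ofFn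

/-- All legal words of length `n`. -/
noncomputable def legalWords (θ : A → Finset (List A)) (n : ℕ) : Finset (List A) :=
  letI := Classical.decPred (Legal θ)
  (allWords A n).filter (Legal θ)

/-- The left shift on bi-infinite sequences. -/
def shift : (ℤ → A) → ℤ → A := fun x i => x (i + 1)

/-- The finite word of length `n` read off a bi-infinite sequence starting at position `m`. -/
def window (x : ℤ → A) (m : ℤ) (n : ℕ) : List A :=
  (List.range n).map fun t => x (m + (t : ℤ))

/-- The random substitution subshift `X_ϑ`. -/
def Xtheta (θ : A → Finset (List A)) : Set (ℤ → A) :=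
  {x | ∀ (m : ℤ) (n : ℕ), Legal θ (window x m n)}

/-- The cylinder set of the word `v` at position `m`. -/
def cylinder (v : List A) (m : ℤ) : Set (ℤ → A) :=
  {x | window x m v.length = v}

/-- The number `|w|_v` of (possibly overlapping) occurrences of `v` in `w`. -/
def occCount (v w : List A) : ℕ :=
  ((List.range w.length).filter fun i => decide (v <+: w.drop i)).length

/-- Expected length `E[|ϑ_P^k(a)|]`. -/
noncomputable def expLen (θ : A → Finset (List A)) (P : A → List A → ℝ)
    (k : ℕ) (a : A) : ℝ :=
  ∑ w ∈ realsIter θ k [a], iterProb θ P k [a] w * (w.length : ℝ)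

/-- Expected number of occurrences `E[|ϑ_P^k(a)|_v]`. -/
noncomputable def expCount (θ : A → Finset (List A)) (P : A → List A → ℝ)
    (k : ℕ) (a : A) (v : List A) : ℝ :=
  ∑ w ∈ realsIter θ k [a], iterProb θ P k [a] w * (occCount v w : ℝ)

/-- `μ` is the frequency measure of `(ϑ, P)`: a shift-invariant Borel probability measure
supported on `X_ϑ` whose cylinder values are the expected word frequencies. -/
def IsFrequencyMeasure [MeasurableSpace A] (θ : A → Finset (List A))
    (P : A → List A → ℝ) (μ : Measure (ℤ → A)) : Prop :=
  IsProbabilityMeasure μ ∧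
    (∀ s : Set (ℤ → A), MeasurableSet s → μ (shift ⁻¹' s) = μ s) ∧
    μ (Xtheta θ) = 1 ∧
    ∀ v : List A, Legal θ v → ∀ (m : ℤ) (a : A),
      Tendsto (fun k : ℕ => expCount θ P k a v / expLen θ P k a) atTop
        (nhds ((μ (cylinder v m)).toReal))

/-- The `n`-th entropy sum `∑_{u ∈ L_ϑ^n} -μ[u] log μ[u]`. -/
noncomputable def entropySeq [MeasurableSpace A] (θ : A → Finset (List A))
    (μ : Measure (ℤ → A)) (n : ℕ) : ℝ :=
  ∑ u ∈ legalWords θ n, Real.negMulLog ((μ (cylinder u 0)).toReal)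

/-- The measure-theoretic (Kolmogorov–Sinai) entropy of the shift with respect to `μ`,
computed along cylinder partitions. -/
noncomputable def measEntropy [MeasurableSpace A] (θ : A → Finset (List A))
    (μ : Measure (ℤ → A)) : ℝ :=
  limsup (fun n : ℕ => entropySeq θ μ n / (n : ℝ)) atTop

/-- The topological entropy of the subshift `X_ϑ`. -/
noncomputable def topEntropy (θ : A → Finset (List A)) : ℝ :=
  limsup (fun n : ℕ => Real.log ((legalWords θ n).card) / (n : ℝ)) atTop

/-- The entropy vector `H_{k,a} = H(ϑ_P^k(a))`. -/
noncomputable def Hvec (θ : A → Finset (List A)) (P : A → List A → ℝ)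
    (k : ℕ) (a : A) : ℝ :=
  ∑ w ∈ realsIter θ k [a], Real.negMulLog (iterProb θ P k [a] w)

/-- The inner product `H_k^T R`. -/
noncomputable def HdotR (θ : A → Finset (List A)) (P : A → List A → ℝ)
    (R : A → ℝ) (k : ℕ) : ℝ :=
  ∑ a, Hvec θ P k a * R a

/-- Binary entropy `H(p) = -p log p - (1-p) log (1-p)`. -/
noncomputable def binEnt (p : ℝ) : ℝ := Real.negMulLog p + Real.negMulLog (1 - p)

/-- Unique realisation paths: concatenation of level-`k` inflation words of the letters of a
legal word is injective. -/
def UniqueRealisationPaths (θ : A → Finset (List A)) : Prop :=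
  ∀ v : List A, Legal θ v → ∀ k : ℕ, ∀ f g : Fin v.length → List A,
    (∀ i, f i ∈ realsIter θ k [v.get i]) → (∀ i, g i ∈ realsIter θ k [v.get i]) →
      (List.ofFn f).flatten = (List.ofFn g).flatten → f = g

/-- The disjoint set condition. -/
def DisjointSetCondition (θ : A → Finset (List A)) : Prop :=
  ∀ (a : A) (k : ℕ), ∀ u ∈ θ a, ∀ v ∈ θ a, u ≠ v →
    ∀ w, w ∈ realsIter θ k u → w ∉ realsIter θ k v

/-- The identical set condition. -/
def IdenticalSetCondition (θ : A → Finset (List A)) : Prop :=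
  ∀ (a : A) (k : ℕ), ∀ u ∈ θ a, ∀ v ∈ θ a, realsIter θ k u = realsIter θ k v

/-- Identical production probabilities. -/
def IdenticalProductionProbabilities (θ : A → Finset (List A))
    (P : A → List A → ℝ) : Prop :=
  ∀ a : A, ∀ u ∈ θ a, ∀ v ∈ θ a, ∀ (k : ℕ) (w : List A),
    iterProb θ P k u w = iterProb θ P k v w

/-- The disjoint set condition for the `k`-th power `ϑ^k`. -/
def DisjointSetConditionPow (θ : A → Finset (List A)) (k : ℕ) : Prop :=
  ∀ (a : A) (j : ℕ), ∀ u ∈ realsIter θ k [a], ∀ v ∈ realsIter θ k [a], u ≠ v →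
    ∀ w, w ∈ realsIter θ (k * j) u → w ∉ realsIter θ (k * j) v

/-- The identical set condition for the `k`-th power `ϑ^k`. -/
def IdenticalSetConditionPow (θ : A → Finset (List A)) (k : ℕ) : Prop :=
  ∀ (a : A) (j : ℕ), ∀ u ∈ realsIter θ k [a], ∀ v ∈ realsIter θ k [a],
    realsIter θ (k * j) u = realsIter θ (k * j) v

/-- Identical production probabilities for the `k`-th power `ϑ^k`. -/
def IdenticalProductionProbabilitiesPow (θ : A → Finset (List A))
    (P : A → List A → ℝ) (k : ℕ) : Prop :=
  ∀ a : A, ∀ u ∈ realsIter θ k [a], ∀ v ∈ realsIter θ k [a], ∀ (j : ℕ) (w : List A),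
    iterProb θ P (k * j) u w = iterProb θ P (k * j) v w

/-- Compatibility: all realisations of a letter have the same abelianisation. -/
def Compatible (θ : A → Finset (List A)) : Prop :=
  ∀ a : A, ∀ u ∈ θ a, ∀ v ∈ θ a, ∀ b : A, u.count b = v.count b

/-- Constant length `ℓ ≥ 2`. -/
def ConstantLength (θ : A → Finset (List A)) (ℓ : ℕ) : Prop :=
  2 ≤ ℓ ∧ ∀ a : A, ∀ w ∈ θ a, w.length = ℓ

/-- The set `ϑ(y)` of bi-infinite sequences obtained by substituting each letter of `y`,
with the image of `y 0` beginning at position `0`. -/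
def substSeq (θ : A → Finset (List A)) (y : ℤ → A) : Set (ℤ → A) :=
  {x | ∃ v : ℤ → List A, (∀ j, v j ∈ θ (y j)) ∧
    ∃ p : ℤ → ℤ, p 0 = 0 ∧ (∀ j, p (j + 1) = p j + (v j).length) ∧
      ∀ (j : ℤ) (t : ℕ) (ht : t < (v j).length), x (p j + (t : ℤ)) = (v j).get ⟨t, ht⟩}

/-- `ϑ(X)` for a set of bi-infinite sequences. -/
def substImage (θ : A → Finset (List A)) (X : Set (ℤ → A)) : Set (ℤ → A) :=
  ⋃ y ∈ X, substSeq θ y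

/-- The set `ϑ^m(y)` of bi-infinite sequences. -/
def substSeqPow (θ : A → Finset (List A)) : ℕ → (ℤ → A) → Set (ℤ → A)
  | 0, y => {y}
  | m + 1, y => ⋃ z ∈ substSeq θ y, substSeqPow θ m z

/-- The maximal length of an inflation word of the letter `a` (equals the common length
when lengths are well-defined). -/
def maxLen (θ : A → Finset (List A)) (a : A) : ℕ := (θ a).sup List.length

/-- Recognisability: every `x ∈ X_ϑ` has a unique inflation-word decomposition. -/
def Recognisable (θ : A → Finset (List A)) : Prop :=
  ∀ x ∈ Xtheta θ, ∃! p : (ℤ → A) × ℕ,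
    p.1 ∈ Xtheta θ ∧ p.2 < maxLen θ (p.1 0) ∧
      (fun i => x (i - (p.2 : ℤ))) ∈ substSeq θ p.1

/-- Recognisability of the `m`-th power of a constant length-`ℓ` substitution. -/
def RecognisablePow (θ : A → Finset (List A)) (m ℓ : ℕ) : Prop :=
  ∀ x ∈ Xtheta θ, ∃! p : (ℤ → A) × ℕ,
    p.1 ∈ Xtheta θ ∧ p.2 < ℓ ^ m ∧
      (fun i => x (i - (p.2 : ℤ))) ∈ substSeqPow θ m p.1

/-- The set `ϑ^m([a])` of exact images of sequences in the cylinder `[a] ⊆ X_ϑ`. -/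
def inflCylPow (θ : A → Finset (List A)) (m : ℕ) (a : A) : Set (ℤ → A) :=
  ⋃ y ∈ {w ∈ Xtheta θ | w 0 = a}, substSeqPow θ m y

/-- `r` is a radius of local recognisability for `ϑ^m`. -/
def RecogPropPow (θ : A → Finset (List A)) (m r : ℕ) : Prop :=
  ∀ (a : A) (x : ℤ → A), x ∈ inflCylPow θ m a → ∀ y ∈ Xtheta θ,
    (∀ t : ℤ, -(r : ℤ) ≤ t → t ≤ (r : ℤ) → x t = y t) → y ∈ inflCylPow θ m a

/-- The recognisability radius `κ(ϑ^m)`. -/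
noncomputable def recogRadiusPow (θ : A → Finset (List A)) (m : ℕ) : ℕ :=
  sInf {r | RecogPropPow θ m r}

/-- The recognisability radius `κ(ϑ)`. -/
noncomputable def recogRadius (θ : A → Finset (List A)) : ℕ := recogRadiusPow θ 1

/-- The random word `ϑ_P^n(a)` is (a.s.) completely determined by `ϑ_P^{n+k}(a)`
in the Markov chain. -/
def DeterminedBy (θ : A → Finset (List A)) (P : A → List A → ℝ)
    (a : A) (n k : ℕ) : Prop :=
  ∀ v₁ v₂ w : List A, v₁ ∈ realsIter θ n [a] → v₂ ∈ realsIter θ n [a] →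
    0 < iterProb θ P n [a] v₁ * iterProb θ P k v₁ w →
      0 < iterProb θ P n [a] v₂ * iterProb θ P k v₂ w → v₁ = v₂

/-- The random words `ϑ_P^n(a)` and `ϑ_P^{n+k}(a)` are independent in the Markov chain. -/
def IndepSteps (θ : A → Finset (List A)) (P : A → List A → ℝ)
    (a : A) (n k : ℕ) : Prop :=
  ∀ v w : List A,
    iterProb θ P n [a] v * iterProb θ P k v w =
      iterProb θ P n [a] v * iterProb θ P (n + k) [a] w

/-- The substitution matrix of a marginal (deterministic) substitution. -/
def marginalM (ρ : A → List A) : Matrix A A ℝ :=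
  Matrix.of fun i j => ((ρ j).count i : ℝ)

/-- Geometric compatibility: a single positive left eigenvector with eigenvalue `λ > 1`
for all marginals. -/
def GeometricallyCompatible (θ : A → Finset (List A)) : Prop :=
  ∃ lam : ℝ, 1 < lam ∧ ∃ L : A → ℝ, (∀ a, 0 < L a) ∧
    ∀ ρ : A → List A, (∀ a, ρ a ∈ θ a) → Matrix.vecMul L (marginalM ρ) = lam • L


set_option linter.unusedSectionVars false

/-! ### Expectations over realisations -/

/-- The expectation of `f (ϑ_P(u))`. -/
noncomputable def substExp (θ : A → Finset (List A)) (P : A → List A → ℝ) (u : List A)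
    (f : List A → ℝ) : ℝ :=
  ∑ w ∈ reals θ u, wordProb θ P u w * f w

/-- The expectation of `f (ϑ_P^n(u))`. -/
noncomputable def iterExp (θ : A → Finset (List A)) (P : A → List A → ℝ) (n : ℕ) (u : List A)
    (f : List A → ℝ) : ℝ :=
  ∑ w ∈ realsIter θ n u, iterProb θ P n u w * f w

section Expectations

variable {θ : A → Finset (List A)} {P : A → List A → ℝ}

lemma mem_reals_cons {a : A} {u w : List A} :
    w ∈ reals θ (a :: u) ↔ ∃ v ∈ θ a, ∃ z ∈ reals θ u, v ++ z = w := by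
  simp [reals]

lemma mem_realsIter_succ {n : ℕ} {u w : List A} :
    w ∈ realsIter θ (n + 1) u ↔ ∃ v ∈ reals θ u, w ∈ realsIter θ n v := by
  simp [realsIter]

lemma wordProb_eq_zero {u w : List A} (h : w ∉ reals θ u) : wordProb θ P u w = 0 := by
  induction u generalizing w with
  | nil => simpa [reals, wordProb] using h
  | cons a u ih =>
    rw [wordProb]
    refine Finset.sum_eq_zero fun v hv => ?_
    split_ifs with hp
    · obtain ⟨z, rfl⟩ := hp
      rw [List.drop_left, ih, mul_zero]
      exact fun hz => h (mem_reals_cons.2 ⟨v, hv, z, hz, rfl⟩)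
    · simp

lemma iterProb_eq_zero {n : ℕ} {u w : List A} (h : w ∉ realsIter θ n u) :
    iterProb θ P n u w = 0 := by
  induction n generalizing u with
  | zero =>
    have : u ≠ w := fun e => h (by simp [realsIter, e])
    simp [iterProb, this]
  | succ n ih =>
    rw [iterProb]
    refine Finset.sum_eq_zero fun v hv => ?_
    rw [ih fun hw => h (mem_realsIter_succ.2 ⟨v, hv, hw⟩), mul_zero]

@[simp] lemma substExp_nil (f : List A → ℝ) : substExp θ P [] f = f [] := by
  simp [substExp, reals, wordProb]

lemma substExp_cons (a : A) (u : List A) (f : List A → ℝ) :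
    substExp θ P (a :: u) f = ∑ v ∈ θ a, P a v * substExp θ P u fun w => f (v ++ w) := by
  simp only [substExp, wordProb, Finset.sum_mul]
  rw [Finset.sum_comm]
  refine Finset.sum_congr rfl fun v hv => ?_
  rw [Finset.mul_sum]
  have hsub : (reals θ u).image (fun z => v ++ z) ⊆ reals θ (a :: u) := by
    intro w hw
    obtain ⟨z, hz, rfl⟩ := Finset.mem_image.1 hw
    exact mem_reals_cons.2 ⟨v, hv, z, hz, rfl⟩
  rw [← Finset.sum_subset hsub]
  · rw [Finset.sum_image fun x _ y _ h => List.append_cancel_left h]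
    refine Finset.sum_congr rfl fun z _ => ?_
    simp [mul_assoc]
  · intro w _ hw
    split_ifs with hp
    · obtain ⟨z, rfl⟩ := hp
      rw [List.drop_left, wordProb_eq_zero]
      · simp
      · exact fun hz => hw (Finset.mem_image_of_mem _ hz)
    · simp

@[simp] lemma iterExp_zero (u : List A) (f : List A → ℝ) : iterExp θ P 0 u f = f u := by
  simp [iterExp, realsIter, iterProb]

lemma iterExp_succ (n : ℕ) (u : List A) (f : List A → ℝ) :
    iterExp θ P (n + 1) u f = substExp θ P u fun v => iterExp θ P n v f := by
  simp only [iterExp, substExp, iterProb, Finset.sum_mul]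
  rw [Finset.sum_comm]
  refine Finset.sum_congr rfl fun v hv => ?_
  rw [Finset.mul_sum]
  have hsub : realsIter θ n v ⊆ realsIter θ (n + 1) u :=
    fun w hw => mem_realsIter_succ.2 ⟨v, hv, hw⟩
  rw [← Finset.sum_subset hsub]
  · exact Finset.sum_congr rfl fun w _ => mul_assoc _ _ _
  · intro w _ hw
    rw [iterProb_eq_zero hw]
    simp

lemma iterExp_add (m n : ℕ) (u : List A) (f : List A → ℝ) :
    iterExp θ P (m + n) u f = iterExp θ P m u fun v => iterExp θ P n v f := by
  induction m generalizing u with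
  | zero => simp
  | succ m ih => rw [Nat.succ_add, iterExp_succ, iterExp_succ]; simp only [ih]

lemma mem_realsIter_add {m n : ℕ} {u w : List A} :
    w ∈ realsIter θ (m + n) u ↔ ∃ v ∈ realsIter θ m u, w ∈ realsIter θ n v := by
  induction m generalizing u with
  | zero => simp [realsIter]
  | succ m ih =>
    rw [Nat.succ_add]
    simp only [mem_realsIter_succ, ih]
    aesop

lemma substExp_append (u u' : List A) (f : List A → ℝ) :
    substExp θ P (u ++ u') f =
      substExp θ P u fun w => substExp θ P u' fun w' => f (w ++ w') := by
  induction u generalizing f with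
  | nil => simp
  | cons a u ih =>
    simp only [List.cons_append, substExp_cons, ih, List.append_assoc]

lemma iterExp_append (n : ℕ) (u u' : List A) (f : List A → ℝ) :
    iterExp θ P n (u ++ u') f =
      iterExp θ P n u fun w => iterExp θ P n u' fun w' => f (w ++ w') := by
  induction n generalizing u u' f with
  | zero => simp
  | succ n ih =>
    simp only [iterExp_succ, substExp_append, ih]
    unfold substExp
    refine Finset.sum_congr rfl fun w _ => ?_
    congr 1
    unfold iterExp
    simp only [Finset.mul_sum]
    rw [Finset.sum_comm]
    refine Finset.sum_congr rfl fun z _ => Finset.sum_congr rfl fun z' _ =>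
      Finset.sum_congr rfl fun z'' _ => by ring

lemma iterExp_nil (n : ℕ) (f : List A → ℝ) : iterExp θ P n [] f = f [] := by
  induction n with
  | zero => simp
  | succ n ih => simp [iterExp_succ, ih]

lemma mem_reals_append {u u' w : List A} :
    w ∈ reals θ (u ++ u') ↔ ∃ v ∈ reals θ u, ∃ v' ∈ reals θ u', v ++ v' = w := by
  induction u generalizing w with
  | nil => simp [reals]
  | cons a u ih =>
    simp only [List.cons_append, mem_reals_cons, ih]
    constructor
    · rintro ⟨v, hv, z, ⟨x, hx, y, hy, rfl⟩, rfl⟩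
      exact ⟨v ++ x, ⟨v, hv, x, hx, rfl⟩, y, hy, by simp⟩
    · rintro ⟨z, ⟨v, hv, x, hx, rfl⟩, y, hy, rfl⟩
      exact ⟨v, hv, x ++ y, ⟨x, hx, y, hy, rfl⟩, by simp⟩

lemma mem_realsIter_append {n : ℕ} {u u' w : List A} :
    w ∈ realsIter θ n (u ++ u') ↔
      ∃ v ∈ realsIter θ n u, ∃ v' ∈ realsIter θ n u', v ++ v' = w := by
  induction n generalizing u u' w with
  | zero => simp [realsIter, eq_comm]
  | succ n ih =>
    simp only [mem_realsIter_succ, mem_reals_append]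
    constructor
    · rintro ⟨_, ⟨x, hx, y, hy, rfl⟩, hw⟩
      obtain ⟨v, hv, v', hv', rfl⟩ := ih.1 hw
      exact ⟨v, ⟨x, hx, hv⟩, v', ⟨y, hy, hv'⟩, rfl⟩
    · rintro ⟨v, ⟨x, hx, hv⟩, v', ⟨y, hy, hv'⟩, rfl⟩
      exact ⟨x ++ y, ⟨x, hx, y, hy, rfl⟩, ih.2 ⟨v, hv, v', hv', rfl⟩⟩

lemma realsIter_nil (n : ℕ) : realsIter θ n [] = {[]} := by
  induction n with
  | zero => rfl
  | succ n ih => simp [realsIter, reals, ih]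

/-- The realisations of `ϑ^n` on words are those of the substitution `a ↦ ϑ^n(a)`. -/
lemma reals_power (n : ℕ) (u : List A) :
    reals (fun a => realsIter θ n [a]) u = realsIter θ n u := by
  induction u with
  | nil => simp [realsIter_nil, reals]
  | cons a u ih =>
    ext w
    rw [mem_reals_cons, ← List.singleton_append (l := u), mem_realsIter_append, ih]

/-- Expectations over `ϑ_P^n` are those of the random substitution `a ↦ ϑ_P^n(a)`. -/
lemma substExp_power (n : ℕ) (u : List A) (f : List A → ℝ) :
    substExp (fun a => realsIter θ n [a]) (fun a => iterProb θ P n [a]) u f =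
      iterExp θ P n u f := by
  induction u generalizing f with
  | nil => simp [iterExp_nil]
  | cons a u ih =>
    rw [substExp_cons, ← List.singleton_append (l := u), iterExp_append]
    simp only [ih]
    rfl

lemma iterExp_congr {n : ℕ} {u : List A} {f g : List A → ℝ}
    (h : ∀ w ∈ realsIter θ n u, f w = g w) : iterExp θ P n u f = iterExp θ P n u g :=
  Finset.sum_congr rfl fun w hw => by rw [h w hw]

lemma iterExp_add_fun (n : ℕ) (u : List A) (f g : List A → ℝ) :
    iterExp θ P n u (fun w => f w + g w) = iterExp θ P n u f + iterExp θ P n u g := by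
  simp [iterExp, mul_add, Finset.sum_add_distrib]

lemma iterExp_mul_const (n : ℕ) (u : List A) (f : List A → ℝ) (c : ℝ) :
    iterExp θ P n u (fun w => f w * c) = iterExp θ P n u f * c := by
  simp [iterExp, Finset.sum_mul, mul_assoc]

lemma iterExp_sum {ι : Type*} (s : Finset ι) (n : ℕ) (u : List A) (f : ι → List A → ℝ) :
    iterExp θ P n u (fun w => ∑ i ∈ s, f i w) = ∑ i ∈ s, iterExp θ P n u (f i) := by
  simp only [iterExp, Finset.mul_sum]
  exact Finset.sum_comm

lemma wordProb_nonneg (h : ∀ a, ∀ w ∈ θ a, 0 ≤ P a w) (u w : List A) :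
    0 ≤ wordProb θ P u w := by
  induction u generalizing w with
  | nil => rw [wordProb]; split_ifs <;> simp
  | cons a u ih =>
    rw [wordProb]
    refine Finset.sum_nonneg fun v hv => mul_nonneg (h a v hv) ?_
    split_ifs
    exacts [ih _, le_rfl]

lemma wordProb_pos (h : ∀ a, ∀ w ∈ θ a, 0 < P a w) {u w : List A} (hw : w ∈ reals θ u) :
    0 < wordProb θ P u w := by
  induction u generalizing w with
  | nil => simp_all [reals, wordProb]
  | cons a u ih =>
    rw [wordProb]
    obtain ⟨v, hv, z, hz, rfl⟩ := mem_reals_cons.1 hw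
    refine Finset.sum_pos' (fun x hx => mul_nonneg (h a x hx).le ?_) ⟨v, hv, ?_⟩
    · split_ifs
      exacts [wordProb_nonneg (fun a w hw => (h a w hw).le) _ _, le_rfl]
    · simpa using mul_pos (h a v hv) (ih hz)

lemma iterProb_pos (h : ∀ a, ∀ w ∈ θ a, 0 < P a w) {n : ℕ} {u w : List A}
    (hw : w ∈ realsIter θ n u) : 0 < iterProb θ P n u w := by
  induction n generalizing u with
  | zero => simp_all [realsIter, iterProb]
  | succ n ih =>
    rw [iterProb]
    obtain ⟨v, hv, hz⟩ := mem_realsIter_succ.1 hw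
    refine Finset.sum_pos' (fun x hx => mul_nonneg (wordProb_pos h hx).le ?_)
      ⟨v, hv, mul_pos (wordProb_pos h hv) (ih hz)⟩
    by_cases hx' : w ∈ realsIter θ n x
    · exact (ih hx').le
    · rw [iterProb_eq_zero hx']

lemma iterExp_mono (h : ∀ a, ∀ w ∈ θ a, 0 < P a w) {n : ℕ} {u : List A} {f g : List A → ℝ}
    (hfg : ∀ w ∈ realsIter θ n u, f w ≤ g w) : iterExp θ P n u f ≤ iterExp θ P n u g :=
  Finset.sum_le_sum fun w hw => mul_le_mul_of_nonneg_left (hfg w hw) (iterProb_pos h hw).le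

lemma substExp_one (h : ∀ a, ∑ w ∈ θ a, P a w = 1) (u : List A) :
    substExp θ P u (fun _ => 1) = 1 := by
  induction u with
  | nil => simp
  | cons a u ih => rw [substExp_cons]; simp [ih, h]

lemma iterExp_one (h : ∀ a, ∑ w ∈ θ a, P a w = 1) (n : ℕ) (u : List A) :
    iterExp θ P n u (fun _ => 1) = 1 := by
  induction n generalizing u with
  | zero => simp
  | succ n ih => rw [iterExp_succ]; simp only [ih, substExp_one h]

lemma iterExp_const (h : ∀ a, ∑ w ∈ θ a, P a w = 1) (n : ℕ) (u : List A) (c : ℝ) :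
    iterExp θ P n u (fun _ => c) = c := by
  simpa [iterExp_one h] using iterExp_mul_const (θ := θ) (P := P) n u (fun _ => 1) c

/-- Expected letter counts of `ϑ_P(u)` are given by the substitution matrix. -/
lemma substExp_count (h : ∀ a, ∑ w ∈ θ a, P a w = 1) (u : List A) (i : A) :
    substExp θ P u (fun w => (w.count i : ℝ)) =
      (substM θ P).mulVec (fun j => (u.count j : ℝ)) i := by
  induction u with
  | nil => simp [Matrix.mulVec, dotProduct]
  | cons a u ih =>
    have key : ∀ v, substExp θ P u (fun w => ((v ++ w).count i : ℝ)) =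
        v.count i + substExp θ P u (fun w => (w.count i : ℝ)) := by
      intro v
      have h1 := substExp_one h u
      simp only [substExp, mul_one] at h1 ⊢
      simp [mul_add, Finset.sum_add_distrib, ← Finset.sum_mul, h1]
    rw [substExp_cons]
    simp only [key, mul_add, Finset.sum_add_distrib, ← Finset.sum_mul, h, ih]
    simp [Matrix.mulVec, dotProduct, List.count_cons, mul_add, Finset.sum_add_distrib, substM,
      add_comm]

lemma iterExp_count (h : ∀ a, ∑ w ∈ θ a, P a w = 1) (n : ℕ) (u : List A) (i : A) :
    iterExp θ P n u (fun w => (w.count i : ℝ)) =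
      (substM θ P ^ n).mulVec (fun j => (u.count j : ℝ)) i := by
  induction n generalizing u with
  | zero => simp
  | succ n ih =>
    have hlin : substExp θ P u (fun v => (substM θ P ^ n).mulVec (fun j => (v.count j : ℝ)) i) =
        (substM θ P ^ n).mulVec (fun j => substExp θ P u (fun v => (v.count j : ℝ))) i := by
      simp only [substExp, Matrix.mulVec, dotProduct, Finset.mul_sum]
      rw [Finset.sum_comm]
      exact Finset.sum_congr rfl fun j _ => Finset.sum_congr rfl fun w _ => by ring
    rw [iterExp_succ]
    simp only [ih]
    rw [hlin, pow_succ, ← Matrix.mulVec_mulVec]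
    simp only [substExp_count h]

end Expectations

/-! ### The Gibbs inequality -/

/-- Gibbs' inequality for an unnormalised reference weight `g`. -/
lemma sum_negMulLog_add_sum_mul_log_le {ι : Type*} {s : Finset ι} {p g : ι → ℝ}
    (hp : ∀ i ∈ s, 0 ≤ p i) (hsum : ∑ i ∈ s, p i = 1) (hg : ∀ i ∈ s, 0 < g i) :
    ∑ i ∈ s, Real.negMulLog (p i) + ∑ i ∈ s, p i * Real.log (g i) ≤
      Real.log (∑ i ∈ s, g i) := by
  have hne : s.Nonempty := by
    rw [Finset.nonempty_iff_ne_empty]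
    rintro rfl
    simp at hsum
  have hS : 0 < ∑ i ∈ s, g i := Finset.sum_pos hg hne
  set S := ∑ i ∈ s, g i with hSdef
  have key : ∀ i ∈ s, Real.negMulLog (p i) + p i * Real.log (g i) ≤
      p i * Real.log S + (g i / S - p i) := by
    intro i hi
    rcases (hp i hi).eq_or_lt with h0 | h0
    · rw [← h0]
      simpa using (div_pos (hg i hi) hS).le
    · have h1 := Real.log_le_sub_one_of_pos (div_pos (hg i hi) (mul_pos h0 hS))
      rw [Real.log_div (hg i hi).ne' (mul_pos h0 hS).ne', Real.log_mul h0.ne' hS.ne'] at h1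
      have h2 := mul_le_mul_of_nonneg_left h1 h0.le
      have h3 : p i * (g i / (p i * S) - 1) = g i / S - p i := by
        field_simp
      rw [h3] at h2
      rw [Real.negMulLog]
      linarith
  have h := Finset.sum_le_sum key
  rw [Finset.sum_add_distrib, Finset.sum_add_distrib, ← Finset.sum_mul, hsum,
    Finset.sum_sub_distrib, hsum, ← Finset.sum_div, ← hSdef, div_self hS.ne'] at h
  linarith

section Counting

variable {θ : A → Finset (List A)} {P : A → List A → ℝ}

lemma reals_nonempty (h : ∀ a, (θ a).Nonempty) (u : List A) : (reals θ u).Nonempty := by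
  induction u with
  | nil => simp [reals]
  | cons a u ih =>
    obtain ⟨v, hv⟩ := h a
    obtain ⟨z, hz⟩ := ih
    exact ⟨v ++ z, mem_reals_cons.2 ⟨v, hv, z, hz, rfl⟩⟩

/-- Gibbs' inequality for the independent blocks of `ϑ_P(u)`: on the right, `g` is summed over all
block decompositions. -/
lemma sum_entropy_add_substExp_log_le (hne : ∀ a, (θ a).Nonempty)
    (hP : ∀ a, ∀ w ∈ θ a, 0 ≤ P a w) (hsum : ∀ a, ∑ w ∈ θ a, P a w = 1)
    (u : List A) {g : List A → ℝ} (hg : ∀ w ∈ reals θ u, 0 < g w) :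
    (u.map fun a => ∑ v ∈ θ a, Real.negMulLog (P a v)).sum +
        substExp θ P u (fun w => Real.log (g w)) ≤
      Real.log (substExp θ (fun _ _ => 1) u g) := by
  induction u generalizing g with
  | nil => simp
  | cons a u ih =>
    have hg' : ∀ v ∈ θ a, ∀ w ∈ reals θ u, 0 < g (v ++ w) :=
      fun v hv w hw => hg _ (mem_reals_cons.2 ⟨v, hv, w, hw, rfl⟩)
    have hpos : ∀ v ∈ θ a, 0 < substExp θ (fun _ _ => 1) u fun w => g (v ++ w) := by
      intro v hv
      exact Finset.sum_pos
        (fun w hw => mul_pos (wordProb_pos (fun _ _ _ => one_pos) hw) (hg' v hv w hw))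
        (reals_nonempty hne u)
    have hgibbs := sum_negMulLog_add_sum_mul_log_le (hP a) (hsum a) hpos
    have hstep : (u.map fun a => ∑ v ∈ θ a, Real.negMulLog (P a v)).sum +
        ∑ v ∈ θ a, P a v * substExp θ P u (fun w => Real.log (g (v ++ w))) ≤
        ∑ v ∈ θ a, P a v * Real.log (substExp θ (fun _ _ => 1) u fun w => g (v ++ w)) := by
      have hconst (x : ℝ) : x = ∑ v ∈ θ a, P a v * x := by rw [← Finset.sum_mul, hsum, one_mul]
      rw [hconst (List.sum _), ← Finset.sum_add_distrib]
      refine Finset.sum_le_sum fun v hv => ?_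
      rw [← mul_add]
      exact mul_le_mul_of_nonneg_left (ih (hg' v hv)) (hP a v hv)
    rw [substExp_cons, substExp_cons, List.map_cons, List.sum_cons]
    simp only [one_mul] at hgibbs ⊢
    linarith

lemma sum_range_choose_eq (n m : ℕ) : ∑ j ∈ Finset.range n, j.choose m = n.choose (m + 1) := by
  induction n with
  | zero => simp
  | succ n ih => rw [Finset.sum_range_succ, ih, Nat.choose_succ_succ, add_comm]

/-- A word has at most `|w|.choose |u|` decompositions into nonempty inflation words of `u`. -/
lemma wordProb_one_le_choose (h : ∀ a, ∀ w ∈ θ a, w ≠ []) (u w : List A) :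
    wordProb θ (fun _ _ => 1) u w ≤ (w.length.choose u.length : ℝ) := by
  induction u generalizing w with
  | nil => rw [wordProb]; split_ifs <;> simp
  | cons a u ih =>
    simp only [wordProb, one_mul]
    rw [← Finset.sum_filter]
    set s := {v ∈ θ a | v <+: w} with hs
    have hle : ∀ v ∈ s, v ≠ [] ∧ v <+: w := fun v hv =>
      ⟨h a v (Finset.mem_filter.1 hv).1, (Finset.mem_filter.1 hv).2⟩
    have hinj : Set.InjOn (fun v : List A => w.length - v.length) s := by
      intro v hv v' hv' e
      have h1 := (hle v hv).2
      have h2 := (hle v' hv').2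
      have hlen : v.length = v'.length := by
        have := h1.length_le
        have := h2.length_le
        simp only at e
        omega
      rw [List.prefix_iff_eq_take] at h1 h2
      rw [h1, h2, hlen]
    calc ∑ v ∈ s, wordProb θ (fun _ _ => 1) u (w.drop v.length)
        ≤ ∑ v ∈ s, ((w.length - v.length).choose u.length : ℝ) :=
          Finset.sum_le_sum fun v _ => by simpa using ih (w.drop v.length)
      _ = ∑ j ∈ s.image (fun v => w.length - v.length), (j.choose u.length : ℝ) :=
          (Finset.sum_image (f := fun j : ℕ => (j.choose u.length : ℝ)) hinj).symm
      _ ≤ ∑ j ∈ Finset.range w.length, (j.choose u.length : ℝ) := by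
          refine Finset.sum_le_sum_of_subset_of_nonneg ?_ fun _ _ _ => by positivity
          intro j hj
          obtain ⟨v, hv, rfl⟩ := Finset.mem_image.1 hj
          have h1 := List.length_pos_iff.2 (hle v hv).1
          have h2 := (hle v hv).2.length_le
          rw [Finset.mem_range]
          omega
      _ = (w.length.choose (u.length + 1) : ℝ) := by
          rw [← sum_range_choose_eq]
          push_cast
          rfl

lemma exists_flatten_eq_of_mem_reals {u w : List A} (hw : w ∈ reals θ u) :
    ∃ f : Fin u.length → List A, (∀ i, f i ∈ θ (u.get i)) ∧ (List.ofFn f).flatten = w := by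
  induction u generalizing w with
  | nil => exact ⟨Fin.elim0, fun i => i.elim0, by simpa [reals, eq_comm] using hw⟩
  | cons a u ih =>
    obtain ⟨v, hv, z, hz, rfl⟩ := mem_reals_cons.1 hw
    obtain ⟨f, hf, rfl⟩ := ih hz
    refine ⟨Fin.cons (α := fun _ => List A) v f, fun i => ?_, ?_⟩
    · induction i using Fin.cases with
      | zero => simpa using hv
      | succ i => simpa using hf i
    · simp [List.ofFn_succ]

/-- If the concatenation map on inflation words of `u` is injective, then every word has at most
one decomposition. -/
lemma wordProb_one_le_one {u : List A}
    (hinj : ∀ f g : Fin u.length → List A, (∀ i, f i ∈ θ (u.get i)) → (∀ i, g i ∈ θ (u.get i)) →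
      (List.ofFn f).flatten = (List.ofFn g).flatten → f = g) (w : List A) :
    wordProb θ (fun _ _ => 1) u w ≤ 1 := by
  induction u generalizing w with
  | nil => rw [wordProb]; split_ifs <;> simp
  | cons a u ih =>
    have hcons : ∀ v ∈ θ a, ∀ f : Fin u.length → List A, (∀ i, f i ∈ θ (u.get i)) →
        ∀ i, (Fin.cons (α := fun _ => List A) v f : Fin (u.length + 1) → List A) i ∈
          θ ((a :: u).get i) := by
      intro v hv f hf i
      induction i using Fin.cases with
      | zero => simpa using hv
      | succ i => simpa using hf i
    have huniq : ∀ v ∈ θ a, ∀ v' ∈ θ a, ∀ f g : Fin u.length → List A,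
        (∀ i, f i ∈ θ (u.get i)) → (∀ i, g i ∈ θ (u.get i)) →
        v ++ (List.ofFn f).flatten = v' ++ (List.ofFn g).flatten → v = v' ∧ f = g := by
      intro v hv v' hv' f g hf hg e
      have := hinj (Fin.cons (α := fun _ => List A) v f) (Fin.cons (α := fun _ => List A) v' g)
        (hcons v hv f hf) (hcons v' hv' g hg) (by simpa [List.ofFn_succ] using e)
      exact ⟨by simpa using congrFun this 0, funext fun i => by simpa using congrFun this i.succ⟩
    rw [wordProb]
    by_cases hall : ∀ v ∈ θ a,
        (if v <+: w then wordProb θ (fun _ _ => 1) u (w.drop v.length) else 0) = 0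
    · rw [Finset.sum_eq_zero fun v hv => by rw [hall v hv, mul_zero]]
      exact zero_le_one
    · push Not at hall
      obtain ⟨v, hv, hne⟩ := hall
      have hmem : ∀ v, (if v <+: w then wordProb θ (fun _ _ => 1) u (w.drop v.length) else 0) ≠ 0 →
          ∃ z ∈ reals θ u, w = v ++ z := by
        intro v hne
        split_ifs at hne with hp
        · obtain ⟨z, rfl⟩ := hp
          rw [List.drop_left] at hne
          exact ⟨z, by_contra fun hz => hne (wordProb_eq_zero hz), rfl⟩
        · exact absurd rfl hne
      rw [Finset.sum_eq_single_of_mem v hv]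
      · have ih' := ih fun f g hf hg e => (huniq v hv v hv f g hf hg (by rw [e])).2
        split_ifs
        · simpa using ih' _
        · simp
      · intro v' hv' hvv'
        by_contra hne'
        obtain ⟨z, hz, rfl⟩ := hmem v hne
        obtain ⟨z', hz', e⟩ := hmem v' (right_ne_zero_of_mul hne')
        obtain ⟨f, hf, rfl⟩ := exists_flatten_eq_of_mem_reals hz
        obtain ⟨g, hg, rfl⟩ := exists_flatten_eq_of_mem_reals hz'
        exact hvv' (huniq v hv v' hv' f g hf hg e).1.symm

end Counting

/-! ### Occurrences of words -/

@[simp] lemma occCount_nil (v : List A) : occCount v [] = 0 := by simp [occCount]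

lemma occCount_cons (v : List A) (c : A) (w : List A) :
    occCount v (c :: w) = (if v <+: c :: w then 1 else 0) + occCount v w := by
  simp only [occCount, List.length_cons, List.range_succ_eq_map, List.filter_cons,
    List.drop_zero, List.filter_map]
  split_ifs <;> simp_all [Function.comp_def, add_comm]

lemma occCount_nil_left (w : List A) : occCount [] w = w.length := by
  simp [occCount]

lemma occCount_add_le (u w w' : List A) :
    occCount u w + occCount u w' ≤ occCount u (w ++ w') := by
  induction w with
  | nil => simp
  | cons c w ih =>
    rw [List.cons_append, occCount_cons, occCount_cons]
    have : (if u <+: c :: w then 1 else 0) ≤ if u <+: c :: (w ++ w') then 1 else 0 := by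
      split_ifs with h1 h2
      · exact le_rfl
      · exact absurd (h1.trans (List.prefix_append (c :: w) w')) h2
      all_goals simp
    omega

lemma occCount_pos {u w : List A} (h : u <:+: w) (hw : w ≠ []) : 0 < occCount u w := by
  rcases u with - | ⟨c, u⟩
  · rw [occCount_nil_left]
    exact List.length_pos_iff.2 hw
  · obtain ⟨s, t, rfl⟩ := h
    have h1 := occCount_add_le (c :: u) s ((c :: u) ++ t)
    have hp : c :: u <+: c :: (u ++ t) := List.prefix_append (c :: u) t
    rw [List.cons_append, occCount_cons, if_pos hp] at h1
    simp only [List.append_assoc, List.cons_append] at h1 ⊢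
    omega

lemma occCount_eq_zero {u w : List A} (h : ¬ u <:+: w) : occCount u w = 0 := by
  simp only [occCount, List.length_eq_zero_iff, List.filter_eq_nil_iff, decide_eq_true_eq]
  exact fun i _ hi => h (hi.isInfix.trans (List.drop_suffix i w).isInfix)

lemma sum_occCount_cons (t w : List A) :
    ∑ c, occCount (c :: t) w + (if t <+: w then 1 else 0) =
      occCount t w + if t = [] then 1 else 0 := by
  induction w with
  | nil => simp
  | cons d w ih =>
    have h1 : ∑ c, (if c :: t <+: d :: w then 1 else 0) = if t <+: w then 1 else 0 := by
      simp only [List.cons_prefix_cons, ite_and, Finset.sum_ite_eq', Finset.mem_univ, if_true]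
    simp only [occCount_cons, Finset.sum_add_distrib, h1]
    omega

lemma mem_allWords {n : ℕ} {w : List A} : w ∈ allWords A n ↔ w.length = n := by
  simp only [allWords, Finset.mem_image, Finset.mem_univ, true_and]
  constructor
  · rintro ⟨f, rfl⟩
    simp
  · rintro rfl
    exact ⟨w.get, List.ofFn_get w⟩

lemma allWords_zero : allWords A 0 = {[]} := by
  ext w
  simp [mem_allWords]

lemma sum_allWords_succ {M : Type*} [AddCommMonoid M] (n : ℕ) (f : List A → M) :
    ∑ w ∈ allWords A (n + 1), f w = ∑ t ∈ allWords A n, ∑ c, f (c :: t) := by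
  rw [← Finset.sum_product']
  symm
  refine Finset.sum_bij (fun x _ => x.2 :: x.1) ?_ ?_ ?_ fun _ _ => rfl
  · intro x hx
    simp_all [mem_allWords]
  · rintro ⟨t, c⟩ _ ⟨t', c'⟩ _ h
    simp_all
  · intro w hw
    rcases w with - | ⟨c, t⟩
    · simp [mem_allWords] at hw
    · exact ⟨(t, c), by simpa [mem_allWords] using hw, rfl⟩

/-! ### Averaging the initial letter over the right eigenvector -/

/-- The expectation of `f (ϑ_P^n(b))` when the letter `b` has distribution `R`. -/
noncomputable def avgExp (θ : A → Finset (List A)) (P : A → List A → ℝ) (R : A → ℝ) (n : ℕ)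
    (f : List A → ℝ) : ℝ :=
  ∑ b, R b * iterExp θ P n [b] f

lemma sum_map_eq_sum_count (H : A → ℝ) (y : List A) :
    (y.map H).sum = ∑ a, (y.count a : ℝ) * H a := by
  induction y with
  | nil => simp
  | cons b y ih => simp [ih, List.count_cons, add_mul, Finset.sum_add_distrib, add_comm]

section Average

variable {θ : A → Finset (List A)} {P : A → List A → ℝ} {R : A → ℝ} {lam : ℝ}

lemma avgExp_iterExp (m n : ℕ) (f : List A → ℝ) :
    avgExp θ P R m (fun v => iterExp θ P n v f) = avgExp θ P R (m + n) f := by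
  simp only [avgExp, iterExp_add]

lemma avgExp_add_fun (n : ℕ) (f g : List A → ℝ) :
    avgExp θ P R n (fun w => f w + g w) = avgExp θ P R n f + avgExp θ P R n g := by
  simp [avgExp, iterExp_add_fun, mul_add, Finset.sum_add_distrib]

lemma avgExp_mul_const (n : ℕ) (f : List A → ℝ) (c : ℝ) :
    avgExp θ P R n (fun w => f w * c) = avgExp θ P R n f * c := by
  simp [avgExp, iterExp_mul_const, Finset.sum_mul, mul_assoc]

lemma avgExp_sum {ι : Type*} (s : Finset ι) (n : ℕ) (f : ι → List A → ℝ) :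
    avgExp θ P R n (fun w => ∑ i ∈ s, f i w) = ∑ i ∈ s, avgExp θ P R n (f i) := by
  simp only [avgExp, iterExp_sum, Finset.mul_sum]
  exact Finset.sum_comm

lemma avgExp_const (hsum : ∀ a, ∑ w ∈ θ a, P a w = 1) (hR : ∑ a, R a = 1) (n : ℕ) (c : ℝ) :
    avgExp θ P R n (fun _ => c) = c := by
  simp [avgExp, iterExp_const hsum, ← Finset.sum_mul, hR]

lemma avgExp_mono (hP : ∀ a, ∀ w ∈ θ a, 0 < P a w) (hR : ∀ a, 0 < R a) {n : ℕ}
    {f g : List A → ℝ} (h : ∀ b, ∀ w ∈ realsIter θ n [b], f w ≤ g w) :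
    avgExp θ P R n f ≤ avgExp θ P R n g :=
  Finset.sum_le_sum fun b _ => mul_le_mul_of_nonneg_left (iterExp_mono hP (h b)) (hR b).le

lemma pow_mulVec_eigenvector (hEig : (substM θ P).mulVec R = lam • R) (n : ℕ) :
    (substM θ P ^ n).mulVec R = lam ^ n • R := by
  induction n with
  | zero => simp
  | succ n ih => rw [pow_succ, ← Matrix.mulVec_mulVec, hEig, Matrix.mulVec_smul, ih, smul_smul,
      pow_succ']

lemma avgExp_count (hsum : ∀ a, ∑ w ∈ θ a, P a w = 1)
    (hEig : (substM θ P).mulVec R = lam • R) (n : ℕ) (i : A) :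
    avgExp θ P R n (fun w => (w.count i : ℝ)) = lam ^ n * R i := by
  have h := congrFun (pow_mulVec_eigenvector hEig n) i
  rw [Pi.smul_apply, smul_eq_mul] at h
  rw [← h]
  simp [avgExp, iterExp_count hsum, Matrix.mulVec, dotProduct, List.count_singleton, mul_comm]

lemma avgExp_sum_map (hsum : ∀ a, ∑ w ∈ θ a, P a w = 1)
    (hEig : (substM θ P).mulVec R = lam • R) (n : ℕ) (H : A → ℝ) :
    avgExp θ P R n (fun w => (w.map H).sum) = lam ^ n * ∑ a, H a * R a := by
  simp only [sum_map_eq_sum_count, avgExp_sum, avgExp_mul_const, avgExp_count hsum hEig,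
    Finset.mul_sum]
  exact Finset.sum_congr rfl fun a _ => by ring

lemma avgExp_length (hsum : ∀ a, ∑ w ∈ θ a, P a w = 1) (hR : ∑ a, R a = 1)
    (hEig : (substM θ P).mulVec R = lam • R) (n : ℕ) :
    avgExp θ P R n (fun w => (w.length : ℝ)) = lam ^ n := by
  simpa [hR] using avgExp_sum_map hsum hEig n (fun _ => 1)

lemma length_le_of_mem_reals (h : ∀ a, ∀ w ∈ θ a, w ≠ []) {u w : List A} (hw : w ∈ reals θ u) :
    u.length ≤ w.length := by
  induction u generalizing w with
  | nil => simp
  | cons a u ih =>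
    obtain ⟨v, hv, z, hz, rfl⟩ := mem_reals_cons.1 hw
    have := List.length_pos_iff.2 (h a v hv)
    have := ih hz
    simp only [List.length_cons, List.length_append]
    omega

lemma length_le_of_mem_realsIter (h : ∀ a, ∀ w ∈ θ a, w ≠ []) {n : ℕ} {u w : List A}
    (hw : w ∈ realsIter θ n u) : u.length ≤ w.length := by
  induction n generalizing u with
  | zero => simp_all [realsIter]
  | succ n ih =>
    obtain ⟨v, hv, hw⟩ := mem_realsIter_succ.1 hw
    exact (length_le_of_mem_reals h hv).trans (ih hw)

lemma ne_nil_of_mem_realsIter (h : ∀ a, ∀ w ∈ θ a, w ≠ []) {n : ℕ} {b : A} {w : List A}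
    (hw : w ∈ realsIter θ n [b]) : w ≠ [] :=
  List.length_pos_iff.1 (length_le_of_mem_realsIter h hw)

lemma length_le_mul_of_mem_reals {K : ℕ} (h : ∀ a, ∀ w ∈ θ a, w.length ≤ K) {u w : List A}
    (hw : w ∈ reals θ u) : w.length ≤ K * u.length := by
  induction u generalizing w with
  | nil => simp_all [reals]
  | cons a u ih =>
    obtain ⟨v, hv, z, hz, rfl⟩ := mem_reals_cons.1 hw
    have := h a v hv
    have := ih hz
    simp only [List.length_cons, List.length_append, mul_add]
    omega

lemma length_le_pow_mul_of_mem_realsIter {K : ℕ} (h : ∀ a, ∀ w ∈ θ a, w.length ≤ K) {n : ℕ}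
    {u w : List A} (hw : w ∈ realsIter θ n u) : w.length ≤ K ^ n * u.length := by
  induction n generalizing u with
  | zero => simp_all [realsIter]
  | succ n ih =>
    obtain ⟨v, hv, hw⟩ := mem_realsIter_succ.1 hw
    calc w.length ≤ K ^ n * v.length := ih hw
      _ ≤ K ^ n * (K * u.length) := Nat.mul_le_mul_left _ (length_le_mul_of_mem_reals h hv)
      _ = K ^ (n + 1) * u.length := by ring

/-- Word frequencies can be computed with the initial letter averaged over `R`. -/
lemma tendsto_avgExp_occCount (hRS : IsRandomSubstitution θ P) (hlam : 0 < lam)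
    (hRpos : ∀ a, 0 < R a) (hRsum : ∑ a, R a = 1) (hEig : (substM θ P).mulVec R = lam • R)
    {v : List A} {x : ℝ}
    (hv : ∀ a, Tendsto (fun n => expCount θ P n a v / expLen θ P n a) atTop (nhds x)) :
    Tendsto (fun n => avgExp θ P R n (fun w => (occCount v w : ℝ)) / lam ^ n) atTop (nhds x) := by
  obtain ⟨-, hnil, hpos, -, hsum⟩ := hRS
  have hlen (n : ℕ) (b : A) : 0 < expLen θ P n b := by
    have h1 : iterExp θ P n [b] (fun _ => 1) ≤ expLen θ P n b :=
      iterExp_mono hpos fun w hw => by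
        exact_mod_cast List.length_pos_iff.2 (ne_nil_of_mem_realsIter hnil hw)
    rw [iterExp_one hsum] at h1
    linarith
  have htot (n : ℕ) : ∑ b, R b * expLen θ P n b / lam ^ n = 1 := by
    rw [← Finset.sum_div, div_eq_one_iff_eq (pow_pos hlam n).ne']
    exact avgExp_length hsum hRsum hEig n
  have hweight (n : ℕ) (b : A) : 0 ≤ R b * expLen θ P n b / lam ^ n :=
    div_nonneg (mul_pos (hRpos b) (hlen n b)).le (pow_pos hlam n).le
  rw [tendsto_iff_norm_sub_tendsto_zero]
  have hbound : Tendsto (fun n => ∑ b, ‖expCount θ P n b v / expLen θ P n b - x‖) atTop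
      (nhds 0) := by
    have := tendsto_finsetSum (Finset.univ : Finset A)
      fun b _ => tendsto_iff_norm_sub_tendsto_zero.1 (hv b)
    simpa using this
  refine squeeze_zero (fun n => norm_nonneg _) (fun n => ?_) hbound
  have heq : avgExp θ P R n (fun w => (occCount v w : ℝ)) / lam ^ n - x =
      ∑ b, R b * expLen θ P n b / lam ^ n * (expCount θ P n b v / expLen θ P n b - x) := by
    simp only [mul_sub, Finset.sum_sub_distrib, ← Finset.sum_mul, htot, one_mul]
    congr 1
    rw [avgExp, Finset.sum_div]
    refine Finset.sum_congr rfl fun b _ => ?_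
    have := (hlen n b).ne'
    change R b * expCount θ P n b v / lam ^ n = _
    field_simp
  rw [heq]
  refine (norm_sum_le _ _).trans (Finset.sum_le_sum fun b _ => ?_)
  rw [norm_mul, Real.norm_of_nonneg (hweight n b)]
  refine mul_le_of_le_one_left (norm_nonneg _) ?_
  rw [← htot n]
  exact Finset.single_le_sum (f := fun b => R b * expLen θ P n b / lam ^ n)
    (fun b _ => hweight n b) (Finset.mem_univ b)

/-- On average, `ϑ_P^n` produces at least as many occurrences of `v` in the image of `y` as in the
images of the separate letters `a` of `y`. -/
lemma count_mul_le_iterExp_occCount (hP : ∀ a, ∀ w ∈ θ a, 0 < P a w)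
    (hsum : ∀ a, ∑ w ∈ θ a, P a w = 1) (n : ℕ) (a : A) (v y : List A) :
    (y.count a : ℝ) * expCount θ P n a v ≤ iterExp θ P n y (fun w => (occCount v w : ℝ)) := by
  induction y with
  | nil => simp [iterExp_nil]
  | cons b y ih =>
    have hnonneg : 0 ≤ expCount θ P n b v := by
      have : iterExp θ P n [b] (fun _ => 0) ≤ expCount θ P n b v :=
        iterExp_mono hP fun w _ => by positivity
      rwa [iterExp_const hsum] at this
    have hsplit : expCount θ P n b v + iterExp θ P n y (fun w => (occCount v w : ℝ)) ≤
        iterExp θ P n (b :: y) (fun w => (occCount v w : ℝ)) := by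
      rw [← List.singleton_append (l := y), iterExp_append]
      calc _ = iterExp θ P n [b] (fun w => (occCount v w : ℝ) +
            iterExp θ P n y (fun w' => (occCount v w' : ℝ))) := by
              rw [iterExp_add_fun, iterExp_const hsum]; rfl
        _ ≤ _ := iterExp_mono hP fun w _ => by
              rw [← iterExp_const (P := P) hsum n y (occCount v w : ℝ), ← iterExp_add_fun]
              exact iterExp_mono hP fun w' _ => by exact_mod_cast occCount_add_le v w w'
    rw [List.count_cons]
    rcases eq_or_ne b a with rfl | hba
    · simp only [beq_self_eq_true, if_true]
      push_cast
      linarith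
    · simp only [beq_iff_eq, hba, if_false, add_zero]
      linarith

end Average

/-! ### Word frequencies and the associated Markov weights -/

lemma Legal.infix {θ : A → Finset (List A)} {u w : List A} (hw : Legal θ w) (h : u <:+: w) :
    Legal θ u := by
  obtain ⟨a, k, z, hz, hwz⟩ := hw
  exact ⟨a, k, z, hz, h.trans hwz⟩

lemma legal_of_mem_realsIter {θ : A → Finset (List A)} {n : ℕ} {b : A} {w : List A}
    (hw : w ∈ realsIter θ n [b]) : Legal θ w :=
  ⟨b, n, w, hw, List.infix_rfl⟩

/-- The weight of a word under the order-`r` Markov approximation (read from right to left) of the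
word frequencies `F`. -/
noncomputable def markovWeight (F : List A → ℝ) (r : ℕ) : List A → ℝ
  | [] => 1
  | c :: w => markovWeight F r w * (F (c :: w.take r) / F (w.take r))

section Frequencies

variable {θ : A → Finset (List A)} {P : A → List A → ℝ} {R : A → ℝ} {lam : ℝ} {F : List A → ℝ}

lemma freq_nil (hRS : IsRandomSubstitution θ P) (hlam : 1 < lam) (hRsum : ∑ a, R a = 1)
    (hEig : (substM θ P).mulVec R = lam • R)
    (hF : ∀ v, Tendsto (fun n => avgExp θ P R n (fun w => (occCount v w : ℝ)) / lam ^ n) atTop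
      (nhds (F v))) : F [] = 1 := by
  refine tendsto_nhds_unique (hF []) (tendsto_const_nhds.congr fun n => ?_)
  simp only [occCount_nil_left, avgExp_length hRS.2.2.2.2 hRsum hEig]
  exact (div_self (pow_pos (by linarith) n).ne').symm

lemma freq_nonneg (hRS : IsRandomSubstitution θ P) (hlam : 1 < lam) (hRpos : ∀ a, 0 < R a)
    (hRsum : ∑ a, R a = 1)
    (hF : ∀ v, Tendsto (fun n => avgExp θ P R n (fun w => (occCount v w : ℝ)) / lam ^ n) atTop
      (nhds (F v))) (v : List A) : 0 ≤ F v := by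
  refine ge_of_tendsto' (hF v) fun n => div_nonneg ?_ (pow_pos (by linarith) n).le
  rw [← avgExp_const (R := R) hRS.2.2.2.2 hRsum n 0]
  exact avgExp_mono hRS.2.2.1 hRpos fun b w _ => by positivity

lemma freq_pos (hRS : IsRandomSubstitution θ P) (hlam : 1 < lam) (hRpos : ∀ a, 0 < R a)
    (hEig : (substM θ P).mulVec R = lam • R)
    (hF : ∀ v, Tendsto (fun n => avgExp θ P R n (fun w => (occCount v w : ℝ)) / lam ^ n) atTop
      (nhds (F v))) {v : List A} (hv : Legal θ v) : 0 < F v := by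
  obtain ⟨-, hnil, hpos, -, hsum⟩ := hRS
  have hl : 0 < lam := by linarith
  obtain ⟨a, k, z, hz, hvz⟩ := hv
  have hcount : 0 < expCount θ P k a v := by
    refine Finset.sum_pos' (fun w hw => mul_nonneg (iterProb_pos hpos hw).le (by positivity))
      ⟨z, hz, mul_pos (iterProb_pos hpos hz) ?_⟩
    exact_mod_cast occCount_pos hvz (ne_nil_of_mem_realsIter hnil hz)
  have hlow : R a * expCount θ P k a v / lam ^ k ≤ F v := by
    refine ge_of_tendsto' ((tendsto_add_atTop_iff_nat k).2 (hF v)) fun n => ?_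
    rw [← avgExp_iterExp, div_le_div_iff₀ (pow_pos hl _) (pow_pos hl _)]
    have h1 : avgExp θ P R n (fun y => (y.count a : ℝ) * expCount θ P k a v) ≤
        avgExp θ P R n (fun y => iterExp θ P k y (fun w => (occCount v w : ℝ))) :=
      avgExp_mono hpos hRpos fun b y _ => count_mul_le_iterExp_occCount hpos hsum k a v y
    rw [avgExp_mul_const, avgExp_count hsum hEig] at h1
    calc R a * expCount θ P k a v * lam ^ (n + k)
        = lam ^ n * R a * expCount θ P k a v * lam ^ k := by ring
      _ ≤ _ := mul_le_mul_of_nonneg_right h1 (pow_pos hl k).le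
  exact (div_pos (mul_pos (hRpos a) hcount) (pow_pos hl k)).trans_le hlow

lemma sum_freq_cons (hRS : IsRandomSubstitution θ P) (hlam : 1 < lam) (hRpos : ∀ a, 0 < R a)
    (hRsum : ∑ a, R a = 1)
    (hF : ∀ v, Tendsto (fun n => avgExp θ P R n (fun w => (occCount v w : ℝ)) / lam ^ n) atTop
      (nhds (F v))) (t : List A) : ∑ c, F (c :: t) = F t := by
  have hl : 0 < lam := by linarith
  obtain ⟨-, -, hpos, -, hsum⟩ := hRS
  have hdiff := (tendsto_finsetSum (Finset.univ : Finset A) fun c _ => hF (c :: t)).sub (hF t)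
  refine sub_eq_zero.1 (tendsto_nhds_unique hdiff ?_)
  have hinv : Tendsto (fun n : ℕ => (lam ^ n)⁻¹) atTop (nhds 0) :=
    tendsto_inv_atTop_zero.comp (tendsto_pow_atTop_atTop_of_one_lt hlam)
  refine squeeze_zero_norm (fun n => ?_) hinv
  have hcount (w : List A) :
      (∑ c, (occCount (c :: t) w : ℝ)) ≤ occCount t w + 1 ∧
      (occCount t w : ℝ) ≤ (∑ c, (occCount (c :: t) w : ℝ)) + 1 := by
    have h := sum_occCount_cons t w
    have h1 : (if t <+: w then 1 else 0) ≤ 1 := by split_ifs <;> simp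
    have h2 : (if t = [] then 1 else 0) ≤ 1 := by split_ifs <;> simp
    constructor
    · exact_mod_cast (by omega : ∑ c, occCount (c :: t) w ≤ occCount t w + 1)
    · exact_mod_cast (by omega : occCount t w ≤ ∑ c, occCount (c :: t) w + 1)
  have hup : ∑ c, avgExp θ P R n (fun w => (occCount (c :: t) w : ℝ)) ≤
      avgExp θ P R n (fun w => (occCount t w : ℝ)) + 1 := by
    rw [← avgExp_sum, ← avgExp_const (R := R) hsum hRsum n 1, ← avgExp_add_fun]
    exact avgExp_mono hpos hRpos fun b w _ => (hcount w).1
  have hlow : avgExp θ P R n (fun w => (occCount t w : ℝ)) ≤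
      ∑ c, avgExp θ P R n (fun w => (occCount (c :: t) w : ℝ)) + 1 := by
    rw [← avgExp_sum, ← avgExp_const (R := R) hsum hRsum n 1, ← avgExp_add_fun]
    exact avgExp_mono hpos hRpos fun b w _ => (hcount w).2
  rw [← Finset.sum_div, ← sub_div, norm_div, Real.norm_of_nonneg (pow_pos hl n).le, inv_eq_one_div]
  refine div_le_div_of_nonneg_right ?_ (pow_pos hl n).le
  rw [Real.norm_eq_abs, abs_le]
  constructor <;> linarith

lemma markovWeight_nonneg (hF : ∀ v, 0 ≤ F v) (r : ℕ) (w : List A) :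
    0 ≤ markovWeight F r w := by
  induction w with
  | nil => simp [markovWeight]
  | cons c w ih => exact mul_nonneg ih (div_nonneg (hF _) (hF _))

lemma take_infix (r : ℕ) (w : List A) : w.take r <:+: w := (List.take_prefix r w).isInfix

lemma infix_cons_self (c : A) (w : List A) : w <:+: c :: w := (List.suffix_cons c w).isInfix

lemma markovWeight_pos (hF : ∀ v, Legal θ v → 0 < F v) (r : ℕ) {w : List A} (hw : Legal θ w) :
    0 < markovWeight F r w := by
  induction w with
  | nil => simp [markovWeight]
  | cons c w ih =>
    have hw' := hw.infix (infix_cons_self c w)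
    exact mul_pos (ih hw') (div_pos (hF _ (hw.infix (take_infix (r + 1) (c :: w))))
      (hF _ (hw'.infix (take_infix r w))))

lemma sum_markovWeight_le_one (hF : ∀ v, 0 ≤ F v) (hcons : ∀ t, ∑ c, F (c :: t) = F t)
    (r n : ℕ) : ∑ w ∈ allWords A n, markovWeight F r w ≤ 1 := by
  induction n with
  | zero => simp [allWords_zero, markovWeight]
  | succ n ih =>
    rw [sum_allWords_succ]
    refine le_trans (Finset.sum_le_sum fun t _ => ?_) ih
    simp only [markovWeight]
    rw [← Finset.mul_sum, ← Finset.sum_div, hcons]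
    exact mul_le_of_le_one_right (markovWeight_nonneg hF r t) (div_self_le_one _)

lemma markovWeight_eq_freq (hF : ∀ v, Legal θ v → 0 < F v) (hnil : F [] = 1) {r : ℕ}
    {w : List A} (hw : Legal θ w) (hlen : w.length ≤ r) : markovWeight F r w = F w := by
  induction w with
  | nil => simp [markovWeight, hnil]
  | cons c w ih =>
    have hw' := hw.infix (infix_cons_self c w)
    simp only [List.length_cons] at hlen
    rw [markovWeight, ih hw' (by omega), List.take_of_length_le (by omega),
      mul_div_cancel₀ _ (hF w hw').ne']

/-- Up to a bounded error, the code length of a legal word is a sum over its subwords. -/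
lemma exists_neg_log_markovWeight_le (hF : ∀ v, Legal θ v → 0 < F v) (hnil : F [] = 1) (r : ℕ) :
    ∃ C : ℝ, ∀ w, Legal θ w → -Real.log (markovWeight F r w) ≤
      ∑ u ∈ allWords A (r + 1),
        (occCount u w : ℝ) * (Real.log (F u.tail) - Real.log (F u)) + C := by
  refine ⟨∑ j ∈ Finset.range (r + 1), ∑ t ∈ allWords A j, |Real.log (F t)|, fun w hw => ?_⟩
  set C := ∑ j ∈ Finset.range (r + 1), ∑ t ∈ allWords A j, |Real.log (F t)| with hC
  have hshort : ∀ w, Legal θ w → w.length ≤ r → -Real.log (markovWeight F r w) ≤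
      ∑ u ∈ allWords A (r + 1),
        (occCount u w : ℝ) * (Real.log (F u.tail) - Real.log (F u)) + C := by
    intro w hw hlen
    rw [markovWeight_eq_freq hF hnil hw hlen, Finset.sum_eq_zero, zero_add]
    · refine (neg_le_abs _).trans ?_
      calc |Real.log (F w)| ≤ ∑ t ∈ allWords A w.length, |Real.log (F t)| :=
            Finset.single_le_sum (f := fun t => |Real.log (F t)|) (fun _ _ => abs_nonneg _)
              (mem_allWords.2 rfl)
        _ ≤ C := Finset.single_le_sum (f := fun j => ∑ t ∈ allWords A j, |Real.log (F t)|)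
              (fun _ _ => Finset.sum_nonneg fun _ _ => abs_nonneg _)
              (Finset.mem_range.2 (by omega))
    · intro u hu
      rw [occCount_eq_zero]
      · simp
      · intro h
        have := h.length_le
        rw [mem_allWords] at hu
        omega
  induction w with
  | nil => exact hshort [] hw (by simp)
  | cons c w ih =>
    by_cases hlen : (c :: w).length ≤ r
    · exact hshort _ hw hlen
    · have hw' := hw.infix (infix_cons_self c w)
      have hlen' : r ≤ w.length := by
        simp only [List.length_cons] at hlen
        omega
      have hlocal : ∑ u ∈ allWords A (r + 1), (((if u <+: c :: w then 1 else 0 : ℕ) : ℝ)) *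
          (Real.log (F u.tail) - Real.log (F u)) =
          Real.log (F (w.take r)) - Real.log (F (c :: w.take r)) := by
        rw [Finset.sum_eq_single (c :: w.take r)]
        · have hp : c :: w.take r <+: c :: w := List.take_prefix (r + 1) (c :: w)
          rw [if_pos hp]
          simp
        · intro u hu hne
          rw [if_neg]
          · simp
          · intro hp
            rw [mem_allWords] at hu
            rw [List.prefix_iff_eq_take, hu, List.take_succ_cons] at hp
            exact hne hp
        · intro h
          exact absurd (mem_allWords.2 (by simpa using hlen')) h
      have h1 := hF _ (hw'.infix (take_infix r w))
      have h2 := hF _ (hw.infix (take_infix (r + 1) (c :: w)))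
      rw [List.take_succ_cons] at h2
      simp only [occCount_cons, Nat.cast_add, add_mul, Finset.sum_add_distrib]
      rw [hlocal, markovWeight, Real.log_mul (markovWeight_pos hF r hw').ne' (div_pos h2 h1).ne',
        Real.log_div h2.ne' h1.ne']
      linarith [ih hw']

end Frequencies

/-! ### The entropy bound -/

section EntropyBound

variable {θ : A → Finset (List A)} {P : A → List A → ℝ} {R : A → ℝ} {lam : ℝ} {F : List A → ℝ}

lemma realsIter_nonempty (h : ∀ a, (θ a).Nonempty) (n : ℕ) (u : List A) :
    (realsIter θ n u).Nonempty := by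
  induction n generalizing u with
  | zero => simp [realsIter]
  | succ n ih =>
    obtain ⟨v, hv⟩ := reals_nonempty h u
    obtain ⟨w, hw⟩ := ih v
    exact ⟨w, mem_realsIter_succ.2 ⟨v, hv, hw⟩⟩

lemma sum_markovWeight_le (hF : ∀ v, 0 ≤ F v) (hcons : ∀ t, ∑ c, F (c :: t) = F t) (r : ℕ)
    {B : ℕ} {s : Finset (List A)} (hs : ∀ w ∈ s, w.length ≤ B) :
    ∑ w ∈ s, markovWeight F r w ≤ B + 1 := by
  have hsub : s ⊆ (Finset.range (B + 1)).biUnion (allWords A) := by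
    intro w hw
    rw [Finset.mem_biUnion]
    exact ⟨w.length, Finset.mem_range.2 (Nat.lt_succ_of_le (hs w hw)), mem_allWords.2 rfl⟩
  have hdisj : Set.PairwiseDisjoint (Finset.range (B + 1) : Set ℕ) (allWords A) := by
    intro i _ j _ hij
    refine Finset.disjoint_left.2 fun w hi hj => hij ?_
    rw [← mem_allWords.1 hi, ← mem_allWords.1 hj]
  calc ∑ w ∈ s, markovWeight F r w
      ≤ ∑ w ∈ (Finset.range (B + 1)).biUnion (allWords A), markovWeight F r w :=
        Finset.sum_le_sum_of_subset_of_nonneg hsub fun w _ _ => markovWeight_nonneg hF r w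
    _ = ∑ n ∈ Finset.range (B + 1), ∑ w ∈ allWords A n, markovWeight F r w :=
        Finset.sum_biUnion hdisj
    _ ≤ ∑ n ∈ Finset.range (B + 1), (1 : ℝ) :=
        Finset.sum_le_sum fun n _ => sum_markovWeight_le_one hF hcons r n
    _ = B + 1 := by simp

/-- Coding the blocks of `ϑ_P^k(y)` by the Markov weight of their concatenation, with an
extra factor `p₁` for each first letter of a block and `p₂` for each other letter. -/
lemma sum_Hvec_add_iterExp_log_le (hRS : IsRandomSubstitution θ P) (hF0 : ∀ v, 0 ≤ F v)
    (hFpos : ∀ v, Legal θ v → 0 < F v) (hcons : ∀ t, ∑ c, F (c :: t) = F t) (r k : ℕ)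
    {B : ℕ} {p₁ p₂ : ℝ} (hp₁ : 0 < p₁) (hp₂ : 0 < p₂) {y : List A}
    (hlegal : ∀ w ∈ realsIter θ k y, Legal θ w) (hB : ∀ w ∈ realsIter θ k y, w.length ≤ B)
    (hcount : ∀ w ∈ realsIter θ k y,
      wordProb (fun a => realsIter θ k [a]) (fun _ _ => 1) y w *
        (p₁ ^ y.length * p₂ ^ (w.length - y.length)) ≤ 1) :
    (y.map (Hvec θ P k)).sum +
        iterExp θ P k y
          (fun w => Real.log (markovWeight F r w) + (w.length : ℝ) * Real.log p₂) +
        (y.length : ℝ) * (Real.log p₁ - Real.log p₂) ≤ Real.log (B + 1) := by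
  obtain ⟨hne, hnil, hpos, -, hsum⟩ := hRS
  set g : List A → ℝ := fun w =>
    markovWeight F r w * (p₁ ^ y.length * p₂ ^ (w.length - y.length)) with hg
  have hgpos : ∀ w ∈ realsIter θ k y, 0 < g w := fun w hw =>
    mul_pos (markovWeight_pos hFpos r (hlegal w hw)) (by positivity)
  have hsumk (a : A) : ∑ w ∈ realsIter θ k [a], iterProb θ P k [a] w = 1 := by
    simpa [iterExp] using iterExp_one hsum k [a]
  have hmain := sum_entropy_add_substExp_log_le (θ := fun a => realsIter θ k [a])
    (P := fun a => iterProb θ P k [a]) (fun a => realsIter_nonempty hne k [a])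
    (fun a w hw => (iterProb_pos hpos hw).le) hsumk y (g := g)
    (by rw [reals_power]; exact hgpos)
  have hlog : iterExp θ P k y (fun w => Real.log (g w)) =
      iterExp θ P k y
        (fun w => Real.log (markovWeight F r w) + (w.length : ℝ) * Real.log p₂) +
      (y.length : ℝ) * (Real.log p₁ - Real.log p₂) := by
    rw [← iterExp_const (P := P) hsum k y ((y.length : ℝ) * (Real.log p₁ - Real.log p₂)),
      ← iterExp_add_fun]
    refine iterExp_congr fun w hw => ?_
    have hq := markovWeight_pos hFpos r (hlegal w hw)
    simp only [hg]
    rw [Real.log_mul hq.ne' (by positivity), Real.log_mul (by positivity) (by positivity),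
      Real.log_pow, Real.log_pow, Nat.cast_sub (length_le_of_mem_realsIter hnil hw)]
    ring
  rw [substExp_power, hlog] at hmain
  rw [add_assoc]
  refine hmain.trans (Real.log_le_log ?_ ?_)
  · rw [substExp, reals_power]
    refine Finset.sum_pos (fun w hw => mul_pos (wordProb_pos (fun _ _ _ => one_pos) ?_)
      (hgpos w hw)) (realsIter_nonempty hne k y)
    rwa [reals_power]
  · rw [substExp, reals_power]
    refine le_trans (Finset.sum_le_sum fun w hw => ?_) (sum_markovWeight_le hF0 hcons r hB)
    calc _ = markovWeight F r w * (wordProb (fun a => realsIter θ k [a]) (fun _ _ => 1) y w *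
          (p₁ ^ y.length * p₂ ^ (w.length - y.length))) := by simp only [hg]; ring
      _ ≤ markovWeight F r w :=
          mul_le_of_le_one_right (markovWeight_nonneg hF0 r w) (hcount w hw)

lemma tendsto_log_pow_add_one_div_pow {K : ℕ} (hK : 1 ≤ K) (hlam : 1 < lam) :
    Tendsto (fun n : ℕ => Real.log ((K ^ n : ℕ) + 1) / lam ^ n) atTop (nhds 0) := by
  have hl : 0 < lam := by linarith
  have hK' : (1 : ℝ) ≤ K := by exact_mod_cast hK
  have hinv : lam⁻¹ < 1 := inv_lt_one_of_one_lt₀ hlam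
  have h1 := (tendsto_pow_atTop_nhds_zero_of_lt_one (inv_pos.2 hl).le hinv).const_mul (Real.log 2)
  have h2 := (tendsto_self_mul_const_pow_of_lt_one (inv_pos.2 hl).le hinv).const_mul (Real.log K)
  have h3 := h1.add h2
  simp only [mul_zero, add_zero] at h3
  refine squeeze_zero (fun n => div_nonneg (Real.log_nonneg ?_) (pow_pos hl n).le)
    (fun n => ?_) h3
  · have : (0 : ℝ) ≤ (K ^ n : ℕ) := by positivity
    linarith
  · have hone : (1 : ℝ) ≤ K ^ n := one_le_pow₀ hK'
    have hle : Real.log ((K ^ n : ℕ) + 1) ≤ Real.log 2 + n * Real.log K := by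
      rw [← Real.log_pow, ← Real.log_mul (by norm_num) (by positivity)]
      refine Real.log_le_log (by positivity) ?_
      push_cast
      linarith
    calc Real.log ((K ^ n : ℕ) + 1) / lam ^ n ≤ (Real.log 2 + n * Real.log K) / lam ^ n :=
          div_le_div_of_nonneg_right hle (pow_pos hl n).le
      _ = _ := by rw [inv_pow]; ring

lemma sum_freq_mul_log_sub (hcons : ∀ t, ∑ c, F (c :: t) = F t) (r : ℕ) :
    ∑ u ∈ allWords A (r + 1), F u * (Real.log (F u.tail) - Real.log (F u)) =
      ∑ u ∈ allWords A (r + 1), Real.negMulLog (F u) -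
        ∑ u ∈ allWords A r, Real.negMulLog (F u) := by
  have h1 : ∑ u ∈ allWords A (r + 1), F u * Real.log (F u.tail) =
      -∑ u ∈ allWords A r, Real.negMulLog (F u) := by
    rw [sum_allWords_succ, ← Finset.sum_neg_distrib]
    refine Finset.sum_congr rfl fun t _ => ?_
    simp only [List.tail_cons]
    rw [← Finset.sum_mul, hcons, Real.negMulLog]
    ring
  simp only [mul_sub, Finset.sum_sub_distrib, h1, Real.negMulLog, neg_mul,
    Finset.sum_neg_distrib]
  ring

/-- The increments of the word entropies are bounded below by the entropy of the blocks of
`ϑ_P^k`, corrected by the cost of marking the block boundaries. -/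
lemma le_entropy_increment (hRS : IsRandomSubstitution θ P) (hlam : 1 < lam)
    (hRpos : ∀ a, 0 < R a) (hRsum : ∑ a, R a = 1) (hEig : (substM θ P).mulVec R = lam • R)
    (hF : ∀ v, Tendsto (fun n => avgExp θ P R n (fun w => (occCount v w : ℝ)) / lam ^ n) atTop
      (nhds (F v)))
    (k : ℕ) {p₁ p₂ : ℝ} (hp₁ : 0 < p₁) (hp₂ : 0 < p₂)
    (hcount : ∀ y, Legal θ y → ∀ w ∈ realsIter θ k y,
      wordProb (fun a => realsIter θ k [a]) (fun _ _ => 1) y w *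
        (p₁ ^ y.length * p₂ ^ (w.length - y.length)) ≤ 1) (r : ℕ) :
    HdotR θ P R k / lam ^ k + (lam ^ k)⁻¹ * Real.log p₁ + (1 - (lam ^ k)⁻¹) * Real.log p₂ ≤
      ∑ u ∈ allWords A (r + 1), Real.negMulLog (F u) -
        ∑ u ∈ allWords A r, Real.negMulLog (F u) := by
  have hl : 0 < lam := by linarith
  have hF0 := freq_nonneg hRS hlam hRpos hRsum hF
  have hFpos : ∀ v, Legal θ v → 0 < F v := fun v hv => freq_pos hRS hlam hRpos hEig hF hv
  have hcons := sum_freq_cons hRS hlam hRpos hRsum hF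
  obtain ⟨C, hC⟩ := exists_neg_log_markovWeight_le hFpos (freq_nil hRS hlam hRsum hEig hF) r
  obtain ⟨-, -, hpos, -, hsum⟩ := id hRS
  obtain ⟨K, hK1, hK⟩ : ∃ K : ℕ, 1 ≤ K ∧ ∀ a, ∀ w ∈ θ a, w.length ≤ K := by
    refine ⟨(Finset.univ.sup fun a => (θ a).sup List.length) + 1, by omega, fun a w hw => ?_⟩
    have h1 := Finset.le_sup (f := List.length) hw
    have h2 := Finset.le_sup (f := fun a => (θ a).sup List.length) (Finset.mem_univ a)
    omega
  have hstep (N : ℕ) : lam ^ N * HdotR θ P R k + lam ^ N * (Real.log p₁ - Real.log p₂) +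
      lam ^ (N + k) * Real.log p₂ ≤
      ∑ u ∈ allWords A (r + 1), avgExp θ P R (N + k) (fun w => (occCount u w : ℝ)) *
        (Real.log (F u.tail) - Real.log (F u)) + C + Real.log ((K ^ (N + k) : ℕ) + 1) := by
    have h1 : avgExp θ P R N (fun y => (y.map (Hvec θ P k)).sum +
        iterExp θ P k y
          (fun w => Real.log (markovWeight F r w) + (w.length : ℝ) * Real.log p₂) +
        (y.length : ℝ) * (Real.log p₁ - Real.log p₂)) ≤ Real.log ((K ^ (N + k) : ℕ) + 1) := by
      rw [← avgExp_const (R := R) hsum hRsum N (Real.log ((K ^ (N + k) : ℕ) + 1))]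
      refine avgExp_mono hpos hRpos fun b y hy => ?_
      have hmem : ∀ w ∈ realsIter θ k y, w ∈ realsIter θ (N + k) [b] :=
        fun w hw => mem_realsIter_add.2 ⟨y, hy, hw⟩
      exact sum_Hvec_add_iterExp_log_le hRS hF0 hFpos hcons r k hp₁ hp₂
        (fun w hw => legal_of_mem_realsIter (hmem w hw))
        (fun w hw => by simpa using length_le_pow_mul_of_mem_realsIter hK (hmem w hw))
        (hcount y (legal_of_mem_realsIter hy))
    rw [avgExp_add_fun, avgExp_add_fun, avgExp_iterExp, avgExp_add_fun, avgExp_mul_const,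
      avgExp_mul_const, avgExp_length hsum hRsum hEig, avgExp_length hsum hRsum hEig,
      avgExp_sum_map hsum hEig] at h1
    have h2 : avgExp θ P R (N + k) (fun w => Real.log (markovWeight F r w) * (-1)) ≤
        avgExp θ P R (N + k) (fun w => ∑ u ∈ allWords A (r + 1),
          (occCount u w : ℝ) * (Real.log (F u.tail) - Real.log (F u)) + C) :=
      avgExp_mono hpos hRpos fun b w hw => by
        rw [mul_neg_one]
        exact hC w (legal_of_mem_realsIter hw)
    rw [avgExp_mul_const, avgExp_add_fun, avgExp_sum, avgExp_const hsum hRsum] at h2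
    simp only [avgExp_mul_const] at h2
    rw [HdotR]
    linarith
  have hlim : Tendsto (fun n : ℕ => (∑ u ∈ allWords A (r + 1),
      avgExp θ P R n (fun w => (occCount u w : ℝ)) / lam ^ n *
        (Real.log (F u.tail) - Real.log (F u))) + C * (lam ^ n)⁻¹ +
        Real.log ((K ^ n : ℕ) + 1) / lam ^ n) atTop
      (nhds (∑ u ∈ allWords A (r + 1), Real.negMulLog (F u) -
        ∑ u ∈ allWords A r, Real.negMulLog (F u))) := by
    have hinv : Tendsto (fun n : ℕ => (lam ^ n)⁻¹) atTop (nhds 0) :=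
      tendsto_inv_atTop_zero.comp (tendsto_pow_atTop_atTop_of_one_lt hlam)
    have h := ((tendsto_finsetSum (allWords A (r + 1)) fun u _ =>
      (hF u).mul_const (Real.log (F u.tail) - Real.log (F u))).add (hinv.const_mul C)).add
        (tendsto_log_pow_add_one_div_pow hK1 hlam)
    rw [sum_freq_mul_log_sub hcons] at h
    simpa using h
  refine ge_of_tendsto' ((tendsto_add_atTop_iff_nat k).2 hlim) fun N => ?_
  have hlk := (pow_pos hl k).ne'
  have hlN := (pow_pos hl N).ne'
  calc _ = (lam ^ N * HdotR θ P R k + lam ^ N * (Real.log p₁ - Real.log p₂) +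
        lam ^ (N + k) * Real.log p₂) / lam ^ (N + k) := by
        rw [pow_add]
        field_simp
        ring
    _ ≤ _ := div_le_div_of_nonneg_right (hstep N) (pow_pos hl (N + k)).le
    _ = _ := by
        rw [add_div, add_div, Finset.sum_div, div_eq_mul_inv C]
        simp only [div_mul_eq_mul_div]

lemma sum_freq_allWords (hnil : F [] = 1) (hcons : ∀ t, ∑ c, F (c :: t) = F t) (n : ℕ) :
    ∑ u ∈ allWords A n, F u = 1 := by
  induction n with
  | zero => simp [allWords_zero, hnil]
  | succ n ih => simp only [sum_allWords_succ, hcons, ih]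

lemma sum_negMulLog_freq_le (hF0 : ∀ v, 0 ≤ F v) (hnil : F [] = 1)
    (hcons : ∀ t, ∑ c, F (c :: t) = F t) (n : ℕ) :
    ∑ u ∈ allWords A n, Real.negMulLog (F u) ≤ n * Real.log (Fintype.card A) := by
  have hsum := sum_freq_allWords hnil hcons n
  have h := sum_negMulLog_add_sum_mul_log_le (s := allWords A n) (p := F) (g := fun _ => 1)
    (fun u _ => hF0 u) hsum (fun _ _ => one_pos)
  simp only [Real.log_one, mul_zero, Finset.sum_const_zero, add_zero, Finset.sum_const,
    nsmul_eq_mul, mul_one] at h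
  refine h.trans ?_
  rw [← Real.log_pow]
  have hne : (allWords A n).Nonempty := by
    rw [Finset.nonempty_iff_ne_empty]
    intro h0
    simp [h0] at hsum
  refine Real.log_le_log (by exact_mod_cast hne.card_pos) ?_
  have hcard : (allWords A n).card ≤ Fintype.card A ^ n := by
    simpa [allWords] using
      Finset.card_image_le (s := (Finset.univ : Finset (Fin n → A))) (f := List.ofFn)
  exact_mod_cast hcard

/-- A lower bound on all entropy increments is a lower bound on the entropy rate. -/
lemma le_limsup_entropy_div (hF0 : ∀ v, 0 ≤ F v) (hnil : F [] = 1)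
    (hcons : ∀ t, ∑ c, F (c :: t) = F t) {c : ℝ}
    (hc : ∀ r, c ≤ ∑ u ∈ allWords A (r + 1), Real.negMulLog (F u) -
      ∑ u ∈ allWords A r, Real.negMulLog (F u)) :
    c ≤ limsup (fun n : ℕ => (∑ u ∈ allWords A n, Real.negMulLog (F u)) / (n : ℝ)) atTop := by
  have hlow (n : ℕ) : n * c ≤ ∑ u ∈ allWords A n, Real.negMulLog (F u) := by
    induction n with
    | zero => simp [allWords_zero, hnil]
    | succ n ih =>
      have := hc n
      push_cast
      linarith
  refine le_limsup_of_frequently_le (Eventually.frequently ?_) ?_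
  · filter_upwards [eventually_gt_atTop 0] with n hn
    have hn' : (0 : ℝ) < n := by exact_mod_cast hn
    rw [le_div_iff₀ hn', mul_comm]
    exact hlow n
  · refine isBoundedUnder_of_eventually_le (a := Real.log (Fintype.card A)) ?_
    filter_upwards [eventually_gt_atTop 0] with n hn
    have hn' : (0 : ℝ) < n := by exact_mod_cast hn
    rw [div_le_iff₀ hn', mul_comm]
    exact sum_negMulLog_freq_le hF0 hnil hcons n

end EntropyBound

lemma choose_mul_pow_le_one {p : ℝ} (h0 : 0 ≤ p) (h1 : p ≤ 1) (n m : ℕ) :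
    (n.choose m : ℝ) * (p ^ m * (1 - p) ^ (n - m)) ≤ 1 := by
  have hq : 0 ≤ 1 - p := by linarith
  rcases lt_or_ge n m with h | h
  · simp [Nat.choose_eq_zero_of_lt h]
  · have hbin := add_pow p (1 - p) n
    rw [add_sub_cancel, one_pow] at hbin
    rw [mul_comm]
    refine le_trans ?_ hbin.ge
    exact Finset.single_le_sum (f := fun m => p ^ m * (1 - p) ^ (n - m) * (n.choose m : ℝ))
      (fun i _ => by positivity) (Finset.mem_range.2 (Nat.lt_succ_of_le h))

/-- The word frequencies given by a frequency measure, extended by zero to illegal words. -/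
noncomputable def measFreq [MeasurableSpace A] (θ : A → Finset (List A)) (μ : Measure (ℤ → A))
    (v : List A) : ℝ :=
  letI := Classical.decPred (Legal θ)
  if Legal θ v then (μ (cylinder v 0)).toReal else 0

lemma tendsto_expCount_div_expLen [MeasurableSpace A] {θ : A → Finset (List A)}
    {P : A → List A → ℝ} {μ : Measure (ℤ → A)} (hμ : IsFrequencyMeasure θ P μ) (v : List A)
    (a : A) :
    Tendsto (fun n => expCount θ P n a v / expLen θ P n a) atTop (nhds (measFreq θ μ v)) := by
  by_cases hv : Legal θ v
  · simpa [measFreq, hv] using hμ.2.2.2 v hv 0 a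
  · have hzero (n : ℕ) : expCount θ P n a v = 0 :=
      Finset.sum_eq_zero fun w hw => by
        rw [occCount_eq_zero fun h => hv ((legal_of_mem_realsIter hw).infix h)]
        simp
    simp [measFreq, hv, hzero]

lemma entropySeq_eq_sum_allWords [MeasurableSpace A] (θ : A → Finset (List A))
    (μ : Measure (ℤ → A)) (n : ℕ) :
    entropySeq θ μ n = ∑ u ∈ allWords A n, Real.negMulLog (measFreq θ μ u) := by
  simp only [entropySeq, legalWords, Finset.sum_filter, measFreq]
  refine Finset.sum_congr rfl fun u _ => ?_
  split_ifs <;> simp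

/-- A lower entropy bound, given a bound on the number of block decompositions. -/
lemma le_measEntropy [MeasurableSpace A] {θ : A → Finset (List A)} {P : A → List A → ℝ}
    {lam : ℝ} {R : A → ℝ} {μ : Measure (ℤ → A)} (hRS : IsRandomSubstitution θ P)
    (hlam : 1 < lam) (hRpos : ∀ a, 0 < R a) (hRsum : ∑ a, R a = 1)
    (hEig : (substM θ P).mulVec R = lam • R) (hμ : IsFrequencyMeasure θ P μ)
    (k : ℕ) {p₁ p₂ : ℝ} (hp₁ : 0 < p₁) (hp₂ : 0 < p₂)
    (hcount : ∀ y, Legal θ y → ∀ w ∈ realsIter θ k y,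
      wordProb (fun a => realsIter θ k [a]) (fun _ _ => 1) y w *
        (p₁ ^ y.length * p₂ ^ (w.length - y.length)) ≤ 1) :
    HdotR θ P R k / lam ^ k + (lam ^ k)⁻¹ * Real.log p₁ + (1 - (lam ^ k)⁻¹) * Real.log p₂ ≤
      measEntropy θ μ := by
  have hF (v : List A) := tendsto_avgExp_occCount hRS (by linarith) hRpos hRsum hEig
    (tendsto_expCount_div_expLen hμ v)
  simp only [measEntropy, entropySeq_eq_sum_allWords]
  exact le_limsup_entropy_div (freq_nonneg hRS hlam hRpos hRsum hF)
    (freq_nil hRS hlam hRsum hEig hF) (sum_freq_cons hRS hlam hRpos hRsum hF)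
    (le_entropy_increment hRS hlam hRpos hRsum hEig hF k hp₁ hp₂ hcount)

theorem statement11 {A : Type*} [Fintype A] [DecidableEq A] [MeasurableSpace A]
    (θ : A → Finset (List A)) (P : A → List A → ℝ) (lam : ℝ) (R : A → ℝ)
    (μ : Measure (ℤ → A))
    (hRS : IsRandomSubstitution θ P) (hprim : IsPrimitive θ P) (hlam : 1 < lam)
    (hRpos : ∀ a, 0 < R a) (hRsum : ∑ a, R a = 1)
    (hEig : (substM θ P).mulVec R = lam • R)
    (hμ : IsFrequencyMeasure θ P μ) :
    (∀ k : ℕ, 1 ≤ k →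
        HdotR θ P R k / lam ^ k - binEnt ((lam ^ k)⁻¹) ≤ measEntropy θ μ) ∧
      (UniqueRealisationPaths θ →
        ∀ k : ℕ, 1 ≤ k → HdotR θ P R k / lam ^ k ≤ measEntropy θ μ) := by
  refine ⟨fun k hk => ?_, fun hU k _ => ?_⟩
  · have hlk : 1 < lam ^ k := one_lt_pow₀ hlam (by omega)
    have hp0 : 0 < (lam ^ k)⁻¹ := inv_pos.2 (by linarith)
    have hp1 : (lam ^ k)⁻¹ < 1 := inv_lt_one_of_one_lt₀ hlk
    have h := le_measEntropy hRS hlam hRpos hRsum hEig hμ k hp0 (sub_pos.2 hp1)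
      fun y _ w _ => by
        refine (mul_le_mul_of_nonneg_right (wordProb_one_le_choose
          (fun a v hv => ne_nil_of_mem_realsIter hRS.2.1 hv) y w) ?_).trans
          (choose_mul_pow_le_one hp0.le hp1.le w.length y.length)
        have := (sub_pos.2 hp1).le
        positivity
    simp only [binEnt, Real.negMulLog]
    linarith
  · have h := le_measEntropy hRS hlam hRpos hRsum hEig hμ k one_pos one_pos
      fun y hy w _ => by simpa using wordProb_one_le_one (hU y hy k) w
    simpa using h

end RandomSubstitutionTheory
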